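/- If R is isomorphic to a finite product of complete discrete valuation rings with finite residue fields (for instance, a finite product of rings of integers of finite extensions of Q_ℓ), then R has the few enlargements property: for every finite R-module A and every ε > 0, the number of isomorphism classes of s-enlargements of A is at most e^{εs} for all sufficiently large s. -/

import Mathlib

/- STATEMENT 18: If R is isomorphic to a finite product of complete discrete valuation
   rings with finite residue fields, then R has the few enlargements property: for every
   finite R-module A and every ε > 0, the number of isomorphism classes of
   s-enlargements of A is at most e^{εs} for all sufficiently large s.

   The R-length of a module is expressed as the Krull dimension (longest chain length)
   of its lattice of R-submodules.  "The number of isomorphism classes of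
   s-enlargements is at most e^{εs}" is expressed as: every finite, pairwise
   non-isomorphic family of s-enlargements of A has cardinality at most e^{εs}. -/

open Filter

/-- The `R`-length of a module: the longest chain length in its submodule lattice. -/
noncomputable def modLength (R M : Type) [CommRing R] [AddCommGroup M] [Module R M] :
    WithBot ℕ∞ :=
  Order.krullDim (Submodule R M)

/-- `B` is an `s`-enlargement of `A`: a finite `R`-module admitting an `R`-module
surjection onto `A` whose kernel has `R`-length equal to `s`. -/
def IsEnlargement (R : Type) [CommRing R] (s : ℕ) (B A : Type) [AddCommGroup B]
    [Module R B] [AddCommGroup A] [Module R A] : Prop :=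
  Finite B ∧ ∃ φ : B →ₗ[R] A, Function.Surjective φ ∧
    modLength R (LinearMap.ker φ) = (s : ℕ∞)

/-- `R` has the few enlargements property: for every finite `R`-module `A`, the number
of isomorphism classes of `s`-enlargements of `A` is subexponential in `s`. -/
def HasFewEnlargements (R : Type) [CommRing R] : Prop :=
  ∀ (A : Type) [AddCommGroup A] [Module R A], Finite A → ∀ ε : ℝ, 0 < ε →
    ∀ᶠ s : ℕ in atTop,
      ∀ (κ : Type) (B : κ → ModuleCat.{0} R), Finite κ →
        (∀ j, IsEnlargement R s (B j) A) →
        (∀ j j', Nonempty ((B j : Type) ≃ₗ[R] B j') → j = j') →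
        (Nat.card κ : ℝ) ≤ Real.exp (ε * s)

section Counting

/-- Weighted counting bound: vectors of multiplicities of weighted size at most `n`, counted with
the weight `x ^ n`, are dominated by the Euler product. -/
lemma card_mul_pow_le_prod {P : Type*} [Fintype P] (w : P → ℕ) (hw : ∀ p, 0 < w p) (n : ℕ)
    (S : Finset (P → ℕ)) (hS : ∀ a ∈ S, ∑ p, a p * w p ≤ n) {x : ℝ} (hx0 : 0 < x) (hx1 : x < 1) :
    (S.card : ℝ) * x ^ n ≤ ∏ p, (1 - x ^ w p)⁻¹ := by
  classical
  have hsub : S ⊆ Fintype.piFinset fun _ : P => Finset.range (n + 1) := by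
    intro a ha
    rw [Fintype.mem_piFinset]
    intro p
    have h1 : a p * w p ≤ ∑ p, a p * w p :=
      Finset.single_le_sum (f := fun p => a p * w p) (fun _ _ => Nat.zero_le _)
        (Finset.mem_univ p)
    have h2 := Nat.le_mul_of_pos_right (a p) (hw p)
    have h3 := hS a ha
    rw [Finset.mem_range]
    omega
  calc (S.card : ℝ) * x ^ n = ∑ a ∈ S, x ^ n := by rw [Finset.sum_const, nsmul_eq_mul]
    _ ≤ ∑ a ∈ S, ∏ p, (x ^ w p) ^ a p := by
        refine Finset.sum_le_sum fun a ha => ?_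
        simp_rw [← pow_mul, Finset.prod_pow_eq_pow_sum]
        refine pow_le_pow_of_le_one hx0.le hx1.le ?_
        simpa only [mul_comm] using hS a ha
    _ ≤ ∑ a ∈ Fintype.piFinset fun _ : P => Finset.range (n + 1), ∏ p, (x ^ w p) ^ a p :=
        Finset.sum_le_sum_of_subset_of_nonneg hsub fun _ _ _ => by positivity
    _ = ∏ p, ∑ k ∈ Finset.range (n + 1), (x ^ w p) ^ k := by rw [Finset.prod_univ_sum]
    _ ≤ ∏ p, (1 - x ^ w p)⁻¹ := by
        refine Finset.prod_le_prod (fun _ _ => by positivity) fun p _ => ?_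
        have hp : x ^ w p < 1 := pow_lt_one₀ hx0.le hx1 (hw p).ne'
        rw [← tsum_geometric_of_lt_one (by positivity) hp]
        exact (summable_geometric_of_lt_one (by positivity) hp).sum_le_tsum _
          fun _ _ => by positivity

/-- The truncated Euler products are bounded independently of the truncation. -/
lemma prod_inv_one_sub_pow_le (ι : Type*) [Fintype ι] {x : ℝ} (hx0 : 0 < x) (hx1 : x < 1) (n : ℕ) :
    ∏ p : ι × Fin n, (1 - x ^ (p.2.1 + 1))⁻¹ ≤
      Real.exp ((Fintype.card ι : ℝ) * ((1 - x)⁻¹ * (1 - x)⁻¹)) := by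
  have h1x : 0 < 1 - x := by linarith
  have key (k : ℕ) : (1 - x ^ (k + 1))⁻¹ ≤ Real.exp (x ^ k * (1 - x)⁻¹) := by
    have hle : x ^ (k + 1) ≤ x := by
      simpa using pow_le_pow_of_le_one hx0.le hx1.le (Nat.le_add_left 1 k)
    have hpos : 0 < 1 - x ^ (k + 1) := by linarith
    have hk : 0 < x ^ k := by positivity
    have : (1 - x ^ (k + 1))⁻¹ ≤ x ^ k * (1 - x)⁻¹ + 1 := by
      have e1 : (1 - x ^ (k + 1))⁻¹ = x ^ (k + 1) * (1 - x ^ (k + 1))⁻¹ + 1 := by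
        field_simp; ring
      rw [e1]
      have e2 : (1 - x ^ (k + 1))⁻¹ ≤ (1 - x)⁻¹ := by gcongr
      have e3 : x ^ (k + 1) ≤ x ^ k := pow_le_pow_of_le_one hx0.le hx1.le (Nat.le_succ k)
      gcongr
    exact this.trans (Real.add_one_le_exp _)
  calc ∏ p : ι × Fin n, (1 - x ^ (p.2.1 + 1))⁻¹
      ≤ ∏ p : ι × Fin n, Real.exp (x ^ p.2.1 * (1 - x)⁻¹) := by
        refine Finset.prod_le_prod (fun p _ => ?_) fun p _ => key _
        exact inv_nonneg.2 (sub_nonneg.2 (pow_le_one₀ hx0.le hx1.le))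
    _ = Real.exp (∑ p : ι × Fin n, x ^ p.2.1 * (1 - x)⁻¹) := (Real.exp_sum _ _).symm
    _ ≤ _ := by
        rw [Fintype.sum_prod_type]
        simp only [Finset.sum_const, nsmul_eq_mul, Finset.card_univ]
        gcongr
        rw [← Finset.sum_mul, Fin.sum_univ_eq_sum_range (fun k => x ^ k)]
        gcongr
        rw [← tsum_geometric_of_lt_one hx0.le hx1]
        exact (summable_geometric_of_lt_one hx0.le hx1).sum_le_tsum _ fun _ _ => by positivity

/-- Two finite families with the same multiplicities differ by a reindexing. -/
lemma exists_equiv_of_card_fiber_eq {P c d : Type*} [Finite c] [Finite d] (t : c → P) (u : d → P)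
    (h : ∀ p, Nat.card {j // t j = p} = Nat.card {j // u j = p}) :
    ∃ σ : c ≃ d, ∀ j, u (σ j) = t j := by
  have f (p : P) := (Finite.card_eq.1 (h p)).some
  let σ : c ≃ d := (Equiv.sigmaFiberEquiv t).symm.trans
    ((Equiv.sigmaCongrRight f).trans (Equiv.sigmaFiberEquiv u))
  exact ⟨σ, fun j => (f (t j) ⟨j, rfl⟩).2⟩

end Counting

section DVR

open IsLocalRing

variable (D : Type) [CommRing D] [IsDomain D] [IsDiscreteValuationRing D]

lemma le_length_quotient_maximalIdeal_pow (n : ℕ) :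
    (n : ℕ∞) ≤ Module.length D (D ⧸ maximalIdeal D ^ n) := by
  rw [Module.length_quotient]
  induction n with
  | zero => simp
  | succ n ih =>
    have hlt : maximalIdeal D ^ (n + 1) < maximalIdeal D ^ n :=
      Ideal.pow_succ_lt_pow (IsDiscreteValuationRing.not_a_field D) n
    push_cast
    exact (add_le_add_left ih 1).trans (Order.coheight_add_one_le hlt)

/-- A finite module over a discrete valuation ring is a finite product of quotients by positive
powers of the maximal ideal. -/
lemma exists_equiv_pi_quotient_maximalIdeal_pow (M : Type) [AddCommGroup M] [Module D M]
    [Finite M] : ∃ (c : Type) (_ : Finite c) (k : c → ℕ),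
      Nonempty (M ≃ₗ[D] ((j : c) → D ⧸ maximalIdeal D ^ (k j + 1))) := by
  classical
  obtain ⟨ϖ, hϖ⟩ := IsDiscreteValuationRing.exists_irreducible D
  have : Infinite D := by
    by_contra h
    have : Finite D := not_infinite_iff_finite.1 h
    exact IsDiscreteValuationRing.not_isField D (Finite.isField_of_domain D)
  have htors : Module.IsTorsion' M (Submonoid.powers ϖ) := by
    intro m
    obtain ⟨r, r', hne, heq⟩ := Finite.exists_ne_map_eq_of_infinite fun r : D => r • m
    obtain ⟨n, u, hu⟩ :=
      IsDiscreteValuationRing.associated_pow_irreducible (sub_ne_zero.2 hne) hϖ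
    refine ⟨⟨ϖ ^ n, n, rfl⟩, ?_⟩
    change ϖ ^ n • m = 0
    rw [← hu, mul_comm, mul_smul, sub_smul, sub_eq_zero.2 heq, smul_zero]
  obtain ⟨d, k, ⟨f⟩⟩ := Module.torsion_by_prime_power_decomposition hϖ htors
  have hpow (n : ℕ) : Ideal.span {ϖ ^ n} = maximalIdeal D ^ n := by
    rw [hϖ.maximalIdeal_eq, Ideal.span_singleton_pow]
  refine ⟨{j : Fin d // k j ≠ 0}, inferInstance, fun j => k j - 1, ⟨f.trans
    ((DirectSum.linearEquivFunOnFintype D (Fin d) _).trans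
      ((LinearEquiv.ofBijective (LinearMap.pi fun j : {j : Fin d // k j ≠ 0} =>
        LinearMap.proj j.1) ⟨?_, ?_⟩).trans
      (LinearEquiv.piCongrRight fun j => Submodule.quotEquivOfEq _ _ ?_)))⟩⟩
  · intro x y hxy
    funext j
    by_cases hj : k j = 0
    · have : Subsingleton (D ⧸ Ideal.span {ϖ ^ k j}) :=
        Ideal.Quotient.subsingleton_iff.2 (by simp [hj])
      exact Subsingleton.elim _ _
    · exact congrFun hxy ⟨j, hj⟩
  · intro y
    exact ⟨fun j => if hj : k j ≠ 0 then y ⟨j, hj⟩ else 0, funext fun j => dif_pos j.2⟩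
  · have := Nat.sub_add_cancel (Nat.pos_of_ne_zero j.2)
    rw [this]
    exact hpow _

end DVR

section Product

open IsLocalRing

variable {R : Type} [CommRing R] {ι : Type} (D : ι → Type)
  [∀ i, CommRing (D i)] [∀ i, Algebra R (D i)]

/-- The standard indecomposable quotients attached to a family of local `R`-algebras. -/
abbrev PrimaryQuotient [∀ i, IsLocalRing (D i)] (p : ι × ℕ) : Type :=
  D p.1 ⧸ maximalIdeal (D p.1) ^ (p.2 + 1)

variable {D}

/-- A module over a finite product ring is a product of modules over the factors. -/
lemma exists_equiv_pi_of_ringEquiv_pi [Finite ι] (e : R ≃+* ((i : ι) → D i))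
    (he : ∀ r i, algebraMap R (D i) r = e r i) (B : Type) [AddCommGroup B] [Module R B]
    [Finite B] :
    ∃ (N : ι → Type) (_ : ∀ i, AddCommGroup (N i)) (_ : ∀ i, Module R (N i))
      (_ : ∀ i, Module (D i) (N i)) (_ : ∀ i, IsScalarTower R (D i) (N i)) (_ : ∀ i, Finite (N i)),
      Nonempty (B ≃ₗ[R] ((i : ι) → N i)) := by
  classical
  have := Fintype.ofFinite ι
  let g (i : ι) (d : D i) : R := e.symm (Pi.single i d)
  have g_add (i : ι) (a b : D i) : g i (a + b) = g i a + g i b := by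
    simp [g, Pi.single_add]
  have g_mul (i : ι) (a b : D i) : g i (a * b) = g i a * g i b := by
    simp [g, Pi.single_mul]
  have g_zero (i : ι) : g i 0 = 0 := by simp [g]
  have g_smul (i : ι) (r : R) (d : D i) : g i (r • d) = r * g i d := by
    apply e.injective
    rw [map_mul]
    funext j
    by_cases h : j = i
    · subst h; simp [g, Algebra.smul_def, he]
    · simp [g, h]
  have g_orth (i j : ι) (h : i ≠ j) : g i 1 * g j 1 = 0 := by
    apply e.injective
    rw [map_mul]
    funext l
    by_cases hl : l = i
    · subst hl; simp [g, h]
    · simp [g, hl]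
  have g_sum : ∑ i, g i 1 = 1 := by
    apply e.injective
    rw [map_sum, map_one]
    funext l
    simp [g, Finset.sum_apply]
  let N (i : ι) : Submodule R B := LinearMap.range (LinearMap.lsmul R B (g i 1))
  have N_one (i : ι) (x : N i) : g i 1 • x = x := by
    obtain ⟨_, y, rfl⟩ := x
    ext
    simp [← mul_smul, ← g_mul]
  let modN (i : ι) : Module (D i) (N i) :=
    { smul := fun d x => g i d • x
      one_smul := N_one i
      mul_smul := fun a b x => by
        change g i (a * b) • x = g i a • g i b • x
        rw [g_mul, mul_smul]
      smul_zero := fun a => smul_zero (g i a)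
      smul_add := fun a => smul_add (g i a)
      add_smul := fun a b x => by
        change g i (a + b) • x = g i a • x + g i b • x
        rw [g_add, add_smul]
      zero_smul := fun x => by
        change g i 0 • x = 0
        rw [g_zero, zero_smul] }
  have tower (i : ι) : IsScalarTower R (D i) (N i) := ⟨fun r d x => by
    change g i (r • d) • x = r • g i d • x
    rw [g_smul, mul_smul]⟩
  refine ⟨fun i => N i, inferInstance, inferInstance, modN, tower, inferInstance,
    ⟨LinearEquiv.ofBijective
      (LinearMap.pi fun i => (LinearMap.lsmul R B (g i 1)).rangeRestrict) ⟨?_, ?_⟩⟩⟩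
  · rw [← LinearMap.ker_eq_bot, LinearMap.ker_eq_bot']
    intro x hx
    have h (i : ι) : g i 1 • x = 0 := congrArg Subtype.val (congrFun hx i)
    rw [← one_smul R x, ← g_sum, Finset.sum_smul]
    exact Finset.sum_eq_zero fun i _ => h i
  · intro y
    refine ⟨∑ j, (y j : B), funext fun i => Subtype.ext ?_⟩
    change g i 1 • ∑ j, (y j : B) = y i
    rw [Finset.smul_sum, Finset.sum_eq_single i]
    · exact congrArg Subtype.val (N_one i (y i))
    · intro j _ hj
      rw [← N_one j (y j), Submodule.coe_smul, ← mul_smul, g_orth i j hj.symm, zero_smul]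
    · simp

variable [∀ i, IsDomain (D i)] [∀ i, IsDiscreteValuationRing (D i)]

/-- A finite module over a finite product of discrete valuation rings is a finite product of
primary quotients. -/
lemma exists_equiv_pi_primaryQuotient [Finite ι] (e : R ≃+* ((i : ι) → D i))
    (he : ∀ r i, algebraMap R (D i) r = e r i) (B : Type) [AddCommGroup B] [Module R B]
    [Finite B] : ∃ (c : Type) (_ : Finite c) (t : c → ι × ℕ),
      Nonempty (B ≃ₗ[R] ((j : c) → PrimaryQuotient D (t j))) := by
  obtain ⟨N, _, _, _, _, _, ⟨f⟩⟩ := exists_equiv_pi_of_ringEquiv_pi e he B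
  choose c hc k h using fun i => exists_equiv_pi_quotient_maximalIdeal_pow (D i) (N i)
  have F (i : ι) : N i ≃ₗ[R] ((j : c i) → PrimaryQuotient D (i, k i j)) :=
    (h i).some.restrictScalars R
  exact ⟨(i : ι) × c i, inferInstance, fun q => (q.1, k q.1 q.2),
    ⟨f.trans ((LinearEquiv.piCongrRight F).trans
      (LinearEquiv.piCurry R fun i j => PrimaryQuotient D (i, k i j)).symm)⟩⟩

lemma le_length_primaryQuotient (hs : ∀ i, Function.Surjective (algebraMap R (D i))) (p : ι × ℕ) :
    ((p.2 + 1 : ℕ) : ℕ∞) ≤ Module.length R (PrimaryQuotient D p) := by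
  rw [Module.length_eq_of_surjective (hs p.1)]
  exact le_length_quotient_maximalIdeal_pow _ _

/-- A module of length at most `n` is a finite product of primary quotients
whose exponents sum to at most `n`. -/
lemma exists_equiv_pi_primaryQuotient_of_length_le [Finite ι] (e : R ≃+* ((i : ι) → D i))
    (he : ∀ r i, algebraMap R (D i) r = e r i) (n : ℕ) (B : Type) [AddCommGroup B] [Module R B]
    [Finite B] (hB : Module.length R B ≤ n) : ∃ (c : Type) (_ : Fintype c) (t : c → ι × Fin n),
      ∑ j, ((t j).2.1 + 1) ≤ n ∧
      Nonempty (B ≃ₗ[R] ((j : c) → PrimaryQuotient D ((t j).1, (t j).2.1))) := by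
  classical
  have hs (i : ι) : Function.Surjective (algebraMap R (D i)) := fun d =>
    ⟨e.symm (Pi.single i d), by simp [he]⟩
  obtain ⟨c, _, t, ⟨f⟩⟩ := exists_equiv_pi_primaryQuotient e he B
  have := Fintype.ofFinite c
  have hsum : ∑ j, ((t j).2 + 1) ≤ n := by
    have : ((∑ j, ((t j).2 + 1) : ℕ) : ℕ∞) ≤ n := by
      rw [f.length_eq, Module.length_pi_of_fintype] at hB
      refine le_trans ?_ hB
      rw [Nat.cast_sum]
      exact Finset.sum_le_sum fun j _ => le_length_primaryQuotient hs (t j)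
    exact_mod_cast this
  have hlt (j : c) : (t j).2 < n :=
    (Finset.single_le_sum (f := fun j => (t j).2 + 1) (fun _ _ => Nat.zero_le _)
      (Finset.mem_univ j)).trans hsum
  exact ⟨c, this, fun j => ((t j).1, ⟨(t j).2, hlt j⟩), hsum, ⟨f⟩⟩

/-- Bound on the number of isomorphism classes of finite modules of length at most `n`. -/
lemma card_mul_pow_le_of_length_le [Fintype ι] (e : R ≃+* ((i : ι) → D i))
    (he : ∀ r i, algebraMap R (D i) r = e r i) (n : ℕ) {κ : Type} [Finite κ]
    (B : κ → ModuleCat.{0} R) (hfin : ∀ j, Finite (B j)) (hB : ∀ j, Module.length R (B j) ≤ n)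
    (hiso : ∀ j j', Nonempty ((B j : Type) ≃ₗ[R] B j') → j = j')
    {x : ℝ} (hx0 : 0 < x) (hx1 : x < 1) :
    (Nat.card κ : ℝ) * x ^ n ≤ Real.exp ((Fintype.card ι : ℝ) * ((1 - x)⁻¹ * (1 - x)⁻¹)) := by
  classical
  have := Fintype.ofFinite κ
  choose c hc t hsum hf using fun j =>
    exists_equiv_pi_primaryQuotient_of_length_le e he n (B j) (hB j)
  let a (j : κ) (p : ι × Fin n) : ℕ := Nat.card {l : c j // t j l = p}
  have ha : Function.Injective a := by
    intro j j' h
    obtain ⟨σ, hσ⟩ := exists_equiv_of_card_fiber_eq (t j) (t j') (congrFun h)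
    have ht : t j = fun l => t j' (σ l) := funext fun l => (hσ l).symm
    have hj := hf j
    rw [ht] at hj
    exact hiso j j' ⟨hj.some.trans ((LinearEquiv.piCongrLeft R
      (fun l => PrimaryQuotient D ((t j' l).1, (t j' l).2.1)) σ).trans (hf j').some.symm)⟩
  have hcount := card_mul_pow_le_prod (fun p : ι × Fin n => p.2.1 + 1) (fun _ => Nat.succ_pos _) n
    (Finset.univ.image a) (by
      simp only [Finset.mem_image, Finset.mem_univ, true_and, forall_exists_index,
        forall_apply_eq_imp_iff]
      intro j
      refine le_trans (le_of_eq ?_) (hsum j)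
      rw [← Fintype.sum_fiberwise' (t j) fun p => p.2.1 + 1]
      refine Finset.sum_congr rfl fun p _ => ?_
      simp [a]) hx0 hx1
  rw [Finset.card_image_of_injective _ ha, Finset.card_univ, ← Nat.card_eq_fintype_card] at hcount
  exact hcount.trans (prod_inv_one_sub_pow_le ι hx0 hx1 n)

end Product

lemma IsEnlargement.length_eq {R : Type} [CommRing R] {s : ℕ} {B A : Type} [AddCommGroup B]
    [Module R B] [AddCommGroup A] [Module R A] (h : IsEnlargement R s B A) :
    Module.length R B = s + Module.length R A := by
  obtain ⟨-, φ, hφ, hker⟩ := h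
  rw [modLength, ← Module.coe_length, WithBot.coe_inj] at hker
  rw [Module.length_eq_add_of_exact (LinearMap.ker φ).subtype φ (Submodule.injective_subtype _) hφ
    (LinearMap.exact_subtype_ker_map φ), hker]

theorem statement18 (R : Type) [CommRing R]
    (ι : Type) [Finite ι] (D : ι → Type)
    [∀ i, CommRing (D i)] [∀ i, IsDomain (D i)] [∀ i, IsDiscreteValuationRing (D i)]
    [∀ i, IsAdicComplete (IsLocalRing.maximalIdeal (D i)) (D i)]
    [∀ i, Finite (IsLocalRing.ResidueField (D i))]
    (e : R ≃+* ((i : ι) → D i)) :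
    HasFewEnlargements R := by
  classical
  have := Fintype.ofFinite ι
  let (i : ι) : Algebra R (D i) := ((Pi.evalRingHom D i).comp e.toRingHom).toAlgebra
  have he (r : R) (i : ι) : algebraMap R (D i) r = e r i := rfl
  intro A _ _ hA ε hε
  obtain ⟨m, hm⟩ := ENat.ne_top_iff_exists.1 (Module.length_ne_top (R := R) (M := A))
  set x : ℝ := Real.exp (-(ε / 2)) with hx
  have hx0 : 0 < x := Real.exp_pos _
  have hx1 : x < 1 := Real.exp_lt_one_iff.2 (by linarith)
  set C : ℝ := (Fintype.card ι : ℝ) * ((1 - x)⁻¹ * (1 - x)⁻¹)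
  have hlarge : ∀ᶠ s : ℕ in atTop, C + ε / 2 * m ≤ ε / 2 * s :=
    (tendsto_natCast_atTop_atTop.const_mul_atTop (half_pos hε)).eventually_ge_atTop _
  filter_upwards [hlarge] with s hs κ B _ hB hiso
  have hlen (j : κ) : Module.length R (B j) ≤ ((s + m : ℕ) : ℕ∞) := by
    rw [(hB j).length_eq, ← hm, Nat.cast_add]
  have hcard := card_mul_pow_le_of_length_le e he (s + m) B (fun j => (hB j).1) hlen hiso hx0 hx1
  rw [hx, ← Real.exp_nat_mul, ← le_div_iff₀ (Real.exp_pos _), ← Real.exp_sub] at hcard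
  refine hcard.trans (Real.exp_le_exp.2 ?_)
  push_cast
  linarith
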